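/- Let N ≥ 3 be an integer and define h(θ) = i^N e^{iθ} (N e^{iθ} − 1)(e^{iθ} − 1)^{N−2} for θ ∈ ℝ. Then h(θ) ≠ 0 for 0 < |θ| ≤ π, and for all θ with 0 < |θ| ≤ π one has Im( h'(θ)/h(θ) ) ≥ (N+2)/2 − 1/(N−1) > 0. Consequently, for every θ ∈ (0, 2π), |Re h(θ)| + |Re h'(θ)| > 0. -/

import Mathlib

/-- On the unit circle, away from `1`, the real part of `z / (z - 1)` is `1 / 2`. -/
theorem re_div_sub_one_of_normSq_eq_one {z : ℂ} (hz : z.re ^ 2 + z.im ^ 2 = 1) (hre : z.re ≠ 1) :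
    (z / (z - 1)).re = 1 / 2 := by
  have h1 : (z.re - 1) * (z.re - 1) + z.im * z.im = 2 * (1 - z.re) := by linear_combination hz
  have h2 : 1 - z.re ≠ 0 := sub_ne_zero.mpr hre.symm
  simp only [Complex.div_re, Complex.normSq_apply, Complex.sub_re, Complex.sub_im, Complex.one_re,
    Complex.one_im, sub_zero, h1]
  field_simp
  linear_combination hz

theorem le_re_mul_div_mul_sub_one {x : ℝ} (hx : 1 < x) {z : ℂ} (hz : z.re ^ 2 + z.im ^ 2 = 1) :
    1 - 1 / (x + 1) ≤ (x * z / (x * z - 1)).re := by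
  have hc : -1 ≤ z.re ∧ z.re ≤ 1 := ⟨by nlinarith [sq_nonneg z.im], by nlinarith [sq_nonneg z.im]⟩
  have h1 : (x * z.re - 1) * (x * z.re - 1) + x * z.im * (x * z.im) =
      x ^ 2 - 2 * x * z.re + 1 := by linear_combination x ^ 2 * hz
  have hD : 0 < x ^ 2 - 2 * x * z.re + 1 := by nlinarith [sq_pos_of_pos (sub_pos.mpr hx)]
  have h2 : (x * z / (x * z - 1)).re = (x ^ 2 - x * z.re) / (x ^ 2 - 2 * x * z.re + 1) := by
    simp only [Complex.div_re, Complex.normSq_apply, Complex.sub_re, Complex.sub_im,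
      Complex.one_re, Complex.one_im, sub_zero, Complex.re_ofReal_mul, Complex.im_ofReal_mul, h1]
    rw [← add_div]
    congr 1
    linear_combination x ^ 2 * hz
  have h3 : 1 - 1 / (x + 1) = x / (x + 1) := by
    have : x + 1 ≠ 0 := by linarith
    field_simp
    ring
  rw [h2, h3, div_le_div_iff₀ (by linarith) hD]
  nlinarith [mul_nonneg (mul_nonneg (sub_nonneg.mpr hx.le) (by linarith : 0 ≤ x))
    (by linarith : 0 ≤ 1 + z.re)]

/-- The logarithmic derivative of `a e^{iθ} (x e^{iθ} - 1) (e^{iθ} - 1)^(n + 1)`. -/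
theorem deriv_div_self_exp_mul (a x : ℂ) (n : ℕ) (θ : ℝ) (ha : a ≠ 0)
    (hx : x * Complex.exp (θ * Complex.I) - 1 ≠ 0) (h1 : Complex.exp (θ * Complex.I) - 1 ≠ 0) :
    deriv (fun t : ℝ => a * Complex.exp (t * Complex.I) * (x * Complex.exp (t * Complex.I) - 1) *
      (Complex.exp (t * Complex.I) - 1) ^ (n + 1)) θ /
      (a * Complex.exp (θ * Complex.I) * (x * Complex.exp (θ * Complex.I) - 1) *
      (Complex.exp (θ * Complex.I) - 1) ^ (n + 1)) =
    Complex.I * (1 + x * Complex.exp (θ * Complex.I) / (x * Complex.exp (θ * Complex.I) - 1) +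
      (((n : ℝ) + 1 : ℝ) : ℂ) *
        (Complex.exp (θ * Complex.I) / (Complex.exp (θ * Complex.I) - 1))) := by
  have he : HasDerivAt (fun t : ℝ => Complex.exp (t * Complex.I))
      (Complex.exp (θ * Complex.I) * Complex.I) θ := by
    simpa using ((Complex.ofRealCLM.hasDerivAt (x := θ)).mul_const Complex.I).cexp
  have hd := ((he.const_mul a).mul ((he.const_mul x).sub_const 1)).mul
    ((he.sub_const 1).pow (n + 1))
  have hz := Complex.exp_ne_zero (θ * Complex.I)
  refine (congrArg (· / _) hd.deriv).trans ?_
  simp only [Pi.mul_apply, Pi.pow_apply, Nat.add_sub_cancel]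
  generalize Complex.exp (θ * Complex.I) = z at *
  have hx' : z * x - 1 ≠ 0 := by rwa [mul_comm]
  push_cast
  field_simp
  ring

/-- Properties of `h(θ) = i^N e^{iθ}(N e^{iθ} - 1)(e^{iθ} - 1)^{N-2}` for `N ≥ 3`:
`h` does not vanish for `0 < |θ| ≤ π`, there `Im(h'/h) ≥ (N+2)/2 - 1/(N-1) > 0`,
and consequently `|Re h(θ)| + |Re h'(θ)| > 0` on `(0, 2π)`. -/
theorem stmt19 (N : ℕ) (hN : 3 ≤ N)
    (h : ℝ → ℂ)
    (hdef : h = fun θ : ℝ => Complex.I ^ N * Complex.exp (θ * Complex.I) *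
      ((N : ℂ) * Complex.exp (θ * Complex.I) - 1) *
      (Complex.exp (θ * Complex.I) - 1) ^ (N - 2)) :
    (∀ θ : ℝ, 0 < |θ| → |θ| ≤ Real.pi → h θ ≠ 0) ∧
    (∀ θ : ℝ, 0 < |θ| → |θ| ≤ Real.pi →
      ((N : ℝ) + 2) / 2 - 1 / ((N : ℝ) - 1) ≤ (deriv h θ / h θ).im) ∧
    (0 < ((N : ℝ) + 2) / 2 - 1 / ((N : ℝ) - 1)) ∧
    (∀ θ : ℝ, θ ∈ Set.Ioo (0:ℝ) (2 * Real.pi) →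
      0 < |(h θ).re| + |(deriv h θ).re|) := by
  have hN' : (3 : ℝ) ≤ N := by exact_mod_cast hN
  have hpos : 0 < ((N : ℝ) + 2) / 2 - 1 / ((N : ℝ) - 1) := by
    have : 1 / ((N : ℝ) - 1) ≤ 1 := by
      rw [div_le_one (by linarith)]
      linarith
    linarith
  have key : ∀ θ : ℝ, Real.cos θ ≠ 1 → h θ ≠ 0 ∧
      ((N : ℝ) + 2) / 2 - 1 / ((N : ℝ) - 1) ≤ (deriv h θ / h θ).im := by
    intro θ hθ
    have hre : (Complex.exp (θ * Complex.I)).re = Real.cos θ := Complex.exp_ofReal_mul_I_re θ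
    have him : (Complex.exp (θ * Complex.I)).im = Real.sin θ := Complex.exp_ofReal_mul_I_im θ
    have hz : (Complex.exp (θ * Complex.I)).re ^ 2 + (Complex.exp (θ * Complex.I)).im ^ 2 = 1 := by
      rw [hre, him, Real.cos_sq_add_sin_sq]
    have h1 : Complex.exp (θ * Complex.I) - 1 ≠ 0 := by
      intro h0
      rw [sub_eq_zero.mp h0] at hre
      exact hθ (by simpa using hre.symm)
    have h2 : (N : ℂ) * Complex.exp (θ * Complex.I) - 1 ≠ 0 := by
      intro h0
      have := congrArg norm (sub_eq_zero.mp h0)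
      rw [norm_mul, Complex.norm_exp_ofReal_mul_I, Complex.norm_natCast, norm_one] at this
      linarith
    have hI : Complex.I ^ N ≠ 0 := pow_ne_zero _ Complex.I_ne_zero
    subst hdef
    refine ⟨mul_ne_zero (mul_ne_zero (mul_ne_zero hI (Complex.exp_ne_zero _)) h2)
      (pow_ne_zero _ h1), ?_⟩
    obtain ⟨n, hn⟩ : ∃ n, N - 2 = n + 1 := ⟨N - 3, by omega⟩
    have hnN : (n : ℝ) = N - 3 := by
      rw [eq_sub_iff_add_eq]
      exact_mod_cast (by omega : n + 3 = N)
    have hb := le_re_mul_div_mul_sub_one (by linarith : (1 : ℝ) < N) hz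
    have hc := re_div_sub_one_of_normSq_eq_one hz (hre ▸ hθ)
    have hle : 1 / ((N : ℝ) + 1) ≤ 1 / ((N : ℝ) - 1) :=
      one_div_le_one_div_of_le (by linarith) (by linarith)
    rw [Complex.ofReal_natCast] at hb
    rw [hn, deriv_div_self_exp_mul _ _ _ _ hI h2 h1, Complex.I_mul_im, Complex.add_re,
      Complex.add_re, Complex.one_re, Complex.re_ofReal_mul, hc, hnN]
    linarith
  have hcos : ∀ θ : ℝ, 0 < |θ| → |θ| < 2 * Real.pi → Real.cos θ ≠ 1 := by
    intro θ h0 h1 hc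
    rw [abs_lt] at h1
    exact abs_pos.mp h0 ((Real.cos_eq_one_iff_of_lt_of_lt h1.1 h1.2).mp hc)
  have hpi := Real.pi_pos
  refine ⟨fun θ h0 h1 => (key θ (hcos θ h0 (by linarith))).1,
    fun θ h0 h1 => (key θ (hcos θ h0 (by linarith))).2, hpos, fun θ hθ => ?_⟩
  have habs : |θ| = θ := abs_of_pos hθ.1
  have hk := (key θ (hcos θ (habs.symm ▸ hθ.1) (habs.symm ▸ hθ.2))).2
  by_contra hcon
  have hr : (h θ).re = 0 := abs_nonpos_iff.mp (by linarith [abs_nonneg (deriv h θ).re])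
  have hr' : (deriv h θ).re = 0 := abs_nonpos_iff.mp (by linarith [abs_nonneg (h θ).re])
  rw [Complex.div_im, hr, hr'] at hk
  simp only [mul_zero, zero_mul, zero_div, sub_zero] at hk
  linarith
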